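/- Let a, b be real numbers with a ≠ 0 and a² + b² < 1, and set c = √(1 − a² − b²). Let L : ℝ² → ℂ³ be defined by L(x,y) = ( (e^{i(ax+by)}/√(1−a²))·( cosh(cy) − (ib/c) sinh(cy) ), e^{i(ax+by)} sinh(cy)/c, a e^{ix/a}/√(1−a²) ). Then for all (x,y) ∈ ℝ², b(L(x,y), L(x,y)) = −1, i.e. −|L₁|² + |L₂|² + |L₃|² = −1; that is, the image of L lies in the pseudo-hyperbolic space H⁵₁(−1) ⊂ ℂ³₁. -/

import Mathlib

/-- The map `L : ℝ² → ℂ³` with `c = √(1 - a² - b²)`: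
`L(x,y) = ((e^{i(ax+by)}/√(1-a²))·(cosh(cy) - (ib/c) sinh(cy)),
           e^{i(ax+by)} sinh(cy)/c, a e^{ix/a}/√(1-a²))`. -/
noncomputable def Lmap (a b x y : ℝ) : Fin 3 → ℂ :=
  let c : ℝ := Real.sqrt (1 - a ^ 2 - b ^ 2)
  ![(Complex.exp (Complex.I * (a * x + b * y)) / (Real.sqrt (1 - a ^ 2) : ℂ)) *
      ((Real.cosh (c * y) : ℝ) - Complex.I * b / c * (Real.sinh (c * y) : ℝ)),
    Complex.exp (Complex.I * (a * x + b * y)) * (Real.sinh (c * y) : ℝ) / (c : ℂ),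
    (a : ℂ) * Complex.exp (Complex.I * x / a) / (Real.sqrt (1 - a ^ 2) : ℂ)]

/-- For `a ≠ 0` with `a² + b² < 1`, the image of `L` lies in the pseudo-hyperbolic space
`H⁵₁(-1) ⊂ ℂ³₁`: `-|L₁|² + |L₂|² + |L₃|² = -1`. -/
theorem Lmap_mem_pseudoHyperbolic :
    ∀ a b : ℝ, a ≠ 0 → a ^ 2 + b ^ 2 < 1 → ∀ x y : ℝ,
      -Complex.normSq (Lmap a b x y 0) + Complex.normSq (Lmap a b x y 1) +
        Complex.normSq (Lmap a b x y 2) = -1 := by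
  intro a b _ hab x y
  have hexp : ∀ z : ℂ, z.re = 0 → Complex.normSq (Complex.exp z) = 1 := by
    intro z hz
    rw [Complex.normSq_eq_norm_sq, Complex.norm_exp, hz]
    simp
  have h1 : Complex.normSq (Complex.exp (Complex.I * (a * x + b * y))) = 1 :=
    hexp _ (by simp)
  have h2 : Complex.normSq (Complex.exp (Complex.I * x / a)) = 1 := by
    refine hexp _ ?_
    rw [mul_div_assoc, ← Complex.ofReal_div]
    simp
  have hd : 0 < 1 - a ^ 2 := by nlinarith [sq_nonneg b]
  have hc : 0 < 1 - a ^ 2 - b ^ 2 := by linarith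
  have hs : Real.sqrt (1 - a ^ 2) ^ 2 = 1 - a ^ 2 := Real.sq_sqrt hd.le
  have hc2 : Real.sqrt (1 - a ^ 2 - b ^ 2) ^ 2 = 1 - a ^ 2 - b ^ 2 := Real.sq_sqrt hc.le
  have hcpos : 0 < Real.sqrt (1 - a ^ 2 - b ^ 2) := Real.sqrt_pos.2 hc
  simp only [Lmap, Matrix.cons_val_zero, Matrix.cons_val_one, Matrix.cons_val]
  generalize Real.sqrt (1 - a ^ 2 - b ^ 2) = c at *
  generalize Real.sqrt (1 - a ^ 2) = s at *
  have h3 : Complex.normSq ((Real.cosh (c * y) : ℝ) -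
      Complex.I * b / c * (Real.sinh (c * y) : ℝ)) =
      Real.cosh (c * y) ^ 2 + b ^ 2 / c ^ 2 * Real.sinh (c * y) ^ 2 := by
    have : ((Real.cosh (c * y) : ℝ) : ℂ) - Complex.I * b / c * (Real.sinh (c * y) : ℝ) =
        (Real.cosh (c * y) : ℝ) + ((-(b / c * Real.sinh (c * y)) : ℝ) : ℂ) * Complex.I := by
      push_cast
      ring
    rw [this, Complex.normSq_add_mul_I]
    ring
  simp only [Complex.normSq_mul, Complex.normSq_div, h1, h2, h3, Complex.normSq_ofReal, ← sq]
  rw [hs, Real.cosh_sq, hc2]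
  field_simp
  ring
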